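/- arXiv:1511.02779 — 2 statements merged into one kernel-verified Lean document; each statement's English description precedes it below -/
import Mathlib

section
/- With the notation of the three-phase null QD example (u₁, u₂, u₃ with parameters a = −c/λ₁, b = c/λ₂, c = √(λ₁λ₂+λ₁λ₃+λ₂λ₃)), for each pair i ≠ j the difference u_{ij} := u_i − u_j satisfies the two-phase equation Δu_{ij} = λ_i·χ_{{u_{ij}>0}} − λ_j·χ_{{u_{ij}<0}} in the interior of the closure of Ω_i ∪ Ω_j, where Ω_i = {u_i > 0}. -/
open MeasureTheory Real

noncomputable section

attribute [local instance] Classical.propDecidable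

/-- The Laplacian of a function on `ℝ²` (as `ℝ × ℝ`), via iterated partial derivatives. -/
def lap2 (f : ℝ × ℝ → ℝ) (p : ℝ × ℝ) : ℝ :=
  deriv (deriv (fun x => f (x, p.2))) p.1 + deriv (deriv (fun y => f (p.1, y))) p.2

/-- The three functions of the explicit three-phase null quadrature domain, each extended
by zero outside its sector. -/
def tripleU (l₁ l₂ l₃ : ℝ) : Fin 3 → ℝ × ℝ → ℝ := fun i p =>
  let c := Real.sqrt (l₁ * l₂ + l₁ * l₃ + l₂ * l₃)
  let a := -c / l₁
  let b := c / l₂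
  if i = 0 then (if 0 ≤ p.2 ∧ a * p.1 ≤ p.2 then l₁ / 2 * (p.2 * (p.2 - a * p.1)) else 0)
  else if i = 1 then
    (if p.2 ≤ 0 ∧ p.2 ≤ b * p.1 then -(l₂ / 2) * (p.2 * (b * p.1 - p.2)) else 0)
  else
    (if b * p.1 ≤ p.2 ∧ p.2 ≤ a * p.1 then
      l₁ * l₂ / (2 * (l₁ + l₂)) * ((a * p.1 - p.2) * (p.2 - b * p.1)) else 0)

/-- Integration by parts twice on the line, for `f` of class `C¹` whose derivative `g` has the
bounded derivative `h` off a countable set. -/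
theorem integral_mul_deriv_deriv_of_off_countable {f g h φ : ℝ → ℝ} {S : Set ℝ} {C : ℝ}
    (hS : S.Countable) (hf : ∀ x, HasDerivAt f (g x) x) (hg : Continuous g)
    (hgh : ∀ x ∉ S, HasDerivAt g (h x) x) (hh : Measurable h) (hC : ∀ x, ‖h x‖ ≤ C)
    (hφ : ContDiff ℝ 2 φ) (hφc : HasCompactSupport φ) :
    ∫ x, f x * deriv (deriv φ) x = ∫ x, h x * φ x := by
  have hφ' : ContDiff ℝ 1 (deriv φ) := ContDiff.iterate_deriv' 1 1 hφ
  have hφ'' : Continuous (deriv (deriv φ)) := hφ'.continuous_deriv le_rfl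
  have hfc : Continuous f := continuous_iff_continuousAt.2 fun x => (hf x).continuousAt
  have hi₁ : Integrable (fun x => f x * deriv (deriv φ) x) :=
    (hfc.mul hφ'').integrable_of_hasCompactSupport hφc.deriv.deriv.mul_left
  have hi₂ : Integrable (fun x => h x * φ x) :=
    (hφ.continuous.integrable_of_hasCompactSupport hφc).bdd_mul hh.aestronglyMeasurable
      (Filter.Eventually.of_forall hC)
  obtain ⟨R, hR, hφR⟩ := hφc.exists_pos_le_norm
  obtain ⟨R', hR', hφR'⟩ := hφc.deriv.exists_pos_le_norm
  obtain ⟨R'', hR'', hφR''⟩ := hφc.deriv.deriv.exists_pos_le_norm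
  set M := R + R' + R'' with hM
  have habs : ∀ x ∉ Set.Ioc (-M) M, M ≤ ‖x‖ := by
    intro x hx
    rw [Real.norm_eq_abs]
    by_contra! hlt
    exact hx ⟨(abs_lt.1 hlt).1, (abs_lt.1 hlt).2.le⟩
  have hsupp : Function.support (fun x => f x * deriv (deriv φ) x - h x * φ x)
      ⊆ Set.Ioc (-M) M := by
    intro x hx
    by_contra hxM
    have := habs x hxM
    refine hx ?_
    simp only
    rw [hφR x (by linarith), hφR'' x (by linarith)]
    ring
  have hend : ∀ x, M ≤ ‖x‖ → f x * deriv φ x - g x * φ x = 0 := by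
    intro x hx
    rw [hφR x (by linarith), hφR' x (by linarith)]
    ring
  have hM0 : 0 ≤ M := by positivity
  have hFTC := integral_eq_of_hasDerivAt_off_countable (a := -M) (b := M)
    (fun x => f x * deriv φ x - g x * φ x) (fun x => f x * deriv (deriv φ) x - h x * φ x) hS
    (by have := hφ.continuous; have := hφ'.continuous; fun_prop) ?_
    (hi₁.sub hi₂).intervalIntegrable
  · rw [intervalIntegral.integral_eq_integral_of_support_subset hsupp, integral_sub hi₁ hi₂,
      hend M (le_abs_self M), hend (-M) (by rw [norm_neg]; exact le_abs_self M)] at hFTC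
    linarith
  · rintro x ⟨-, hx⟩
    have d₁ := (hφ.differentiable (by norm_num) x).hasDerivAt
    have d₂ := (hφ'.differentiable (by norm_num) x).hasDerivAt
    exact (((hf x).mul d₂).sub ((hgh x hx).mul d₁)).congr_deriv (by ring)

/-- The second partial derivative in the first variable as a directional derivative. -/
theorem deriv_deriv_fst_eq_fderiv {ψ : ℝ × ℝ → ℝ} (hψ : ContDiff ℝ 2 ψ) (p : ℝ × ℝ) :
    deriv (deriv (fun x => ψ (x, p.2))) p.1
      = fderiv ℝ (fun q => fderiv ℝ ψ q (1, 0)) p (1, 0) := by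
  have key : ∀ F : ℝ × ℝ → ℝ, Differentiable ℝ F → ∀ x y,
      deriv (fun t => F (t, y)) x = fderiv ℝ F (x, y) (1, 0) := by
    intro F hF x y
    have hline : HasDerivAt (fun t : ℝ => (t, y)) ((1 : ℝ), (0 : ℝ)) x :=
      (hasDerivAt_id x).prodMk (hasDerivAt_const x y)
    exact ((hF (x, y)).hasFDerivAt.comp_hasDerivAt x hline).deriv
  have h1 : ContDiff ℝ 1 (fun q => fderiv ℝ ψ q (1, 0)) :=
    (hψ.fderiv_right (m := 1) (by norm_num)).clm_apply contDiff_const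
  rw [funext fun x => key ψ (hψ.differentiable (by norm_num)) x p.2]
  exact key _ (h1.differentiable (by norm_num)) p.1 p.2

theorem continuous_deriv_deriv_fst {ψ : ℝ × ℝ → ℝ} (hψ : ContDiff ℝ 2 ψ) :
    Continuous fun p : ℝ × ℝ => deriv (deriv (fun x => ψ (x, p.2))) p.1 := by
  have h1 : ContDiff ℝ 1 (fun q => fderiv ℝ ψ q (1, 0)) :=
    (hψ.fderiv_right (m := 1) (by norm_num)).clm_apply contDiff_const
  rw [funext (deriv_deriv_fst_eq_fderiv hψ)]
  exact (h1.continuous_fderiv (by norm_num)).clm_apply continuous_const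

theorem hasCompactSupport_deriv_deriv_fst {ψ : ℝ × ℝ → ℝ} (hψ : ContDiff ℝ 2 ψ)
    (hψc : HasCompactSupport ψ) :
    HasCompactSupport fun p : ℝ × ℝ => deriv (deriv (fun x => ψ (x, p.2))) p.1 := by
  rw [funext (deriv_deriv_fst_eq_fderiv hψ)]
  exact (hψc.fderiv_apply ℝ (1, 0)).fderiv_apply ℝ (1, 0)

/-- The function of one variable whose second derivative is `A` on the positive half-line and
`-B` on the negative one, and which vanishes to first order at the origin. -/
def twoPhase (A B t : ℝ) : ℝ := A / 2 * max t 0 ^ 2 - B / 2 * max (-t) 0 ^ 2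

/-- The derivative of `twoPhase`. -/
def twoPhaseDeriv (A B t : ℝ) : ℝ := A * max t 0 + B * max (-t) 0

/-- The second derivative of `twoPhase` away from the origin. -/
def twoPhaseDensity (A B t : ℝ) : ℝ := if 0 < t then A else if t < 0 then -B else 0

theorem hasDerivAt_max_zero_sq (t : ℝ) : HasDerivAt (fun t : ℝ => max t 0 ^ 2) (2 * max t 0) t := by
  rcases lt_trichotomy t 0 with ht | rfl | ht
  · rw [max_eq_right ht.le, mul_zero]
    refine (hasDerivAt_const t (0 : ℝ)).congr_of_eventuallyEq ?_
    filter_upwards [Iio_mem_nhds ht] with s hs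
    simp [max_eq_right (Set.mem_Iio.1 hs).le]
  · simp only [max_self, mul_zero]
    rw [hasDerivAt_iff_isLittleO]
    simp only [sub_zero, max_self, smul_eq_mul, mul_zero, ne_eq, OfNat.ofNat_ne_zero,
      not_false_eq_true, zero_pow]
    have h2 : (fun t : ℝ => max t 0 ^ 2) =O[nhds 0] fun t : ℝ => t ^ 2 := by
      refine Asymptotics.IsBigO.of_bound 1 (Filter.Eventually.of_forall fun s => ?_)
      rw [one_mul, norm_pow, norm_pow]
      gcongr
      rw [Real.norm_eq_abs, Real.norm_eq_abs, abs_of_nonneg (le_max_right s 0)]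
      exact max_le (le_abs_self s) (abs_nonneg s)
    exact h2.trans_isLittleO (Asymptotics.isLittleO_pow_id one_lt_two)
  · rw [max_eq_left ht.le]
    have : HasDerivAt (fun s : ℝ => s ^ 2) (2 * t) t := by simpa using hasDerivAt_pow 2 t
    refine this.congr_of_eventuallyEq ?_
    filter_upwards [Ioi_mem_nhds ht] with s hs
    rw [max_eq_left (Set.mem_Ioi.1 hs).le]

theorem hasDerivAt_twoPhase (A B t : ℝ) :
    HasDerivAt (twoPhase A B) (twoPhaseDeriv A B t) t := by
  have h₁ := (hasDerivAt_max_zero_sq t).const_mul (A / 2)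
  have h₂ := ((hasDerivAt_max_zero_sq (-t)).scomp t (hasDerivAt_neg t)).const_mul (B / 2)
  exact (h₁.sub h₂).congr_deriv (by simp only [twoPhaseDeriv, smul_eq_mul]; ring)

theorem hasDerivAt_twoPhaseDeriv (A B : ℝ) {t : ℝ} (ht : t ≠ 0) :
    HasDerivAt (twoPhaseDeriv A B) (twoPhaseDensity A B t) t := by
  rcases lt_or_gt_of_ne ht with ht | ht
  · have h : HasDerivAt (fun s : ℝ => -B * s) (twoPhaseDensity A B t) t := by
      simpa [twoPhaseDensity, ht, ht.not_gt] using (hasDerivAt_id t).const_mul (-B)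
    refine h.congr_of_eventuallyEq ?_
    filter_upwards [Iio_mem_nhds ht] with s hs
    have hs : s < 0 := hs
    rw [twoPhaseDeriv, max_eq_right hs.le, max_eq_left (by linarith)]
    ring
  · have h : HasDerivAt (fun s : ℝ => A * s) (twoPhaseDensity A B t) t := by
      simpa [twoPhaseDensity, ht] using (hasDerivAt_id t).const_mul A
    refine h.congr_of_eventuallyEq ?_
    filter_upwards [Ioi_mem_nhds ht] with s hs
    have hs : 0 < s := hs
    rw [twoPhaseDeriv, max_eq_left hs.le, max_eq_right (by linarith)]
    ring

theorem continuous_twoPhase (A B : ℝ) : Continuous (twoPhase A B) := by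
  unfold twoPhase; fun_prop

theorem continuous_twoPhaseDeriv (A B : ℝ) : Continuous (twoPhaseDeriv A B) := by
  unfold twoPhaseDeriv; fun_prop

theorem measurable_twoPhaseDensity (A B : ℝ) : Measurable (twoPhaseDensity A B) :=
  Measurable.ite measurableSet_Ioi measurable_const
    (Measurable.ite measurableSet_Iio measurable_const measurable_const)

theorem norm_twoPhaseDensity_le (A B t : ℝ) : ‖twoPhaseDensity A B t‖ ≤ |A| + |B| := by
  unfold twoPhaseDensity
  split_ifs <;> simp [abs_nonneg, add_nonneg]

/-- A harmonic quadratic form plus a two-phase function of the linear form `α x + β y`. -/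
def quadTwoPhase (m q A B α β : ℝ) (p : ℝ × ℝ) : ℝ :=
  m * p.1 ^ 2 + q * (p.1 * p.2) - m * p.2 ^ 2 + twoPhase A B (α * p.1 + β * p.2)

theorem continuous_quadTwoPhase (m q A B α β : ℝ) : Continuous (quadTwoPhase m q A B α β) := by
  have := continuous_twoPhase A B
  unfold quadTwoPhase
  fun_prop

theorem integrable_quadTwoPhase_mul_deriv_deriv_fst (m q A B α β : ℝ) {ψ : ℝ × ℝ → ℝ}
    (hψ : ContDiff ℝ 2 ψ) (hψc : HasCompactSupport ψ) :
    Integrable fun p : ℝ × ℝ =>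
      quadTwoPhase m q A B α β p * deriv (deriv (fun x => ψ (x, p.2))) p.1 :=
  ((continuous_quadTwoPhase m q A B α β).mul
    (continuous_deriv_deriv_fst hψ)).integrable_of_hasCompactSupport
      (hasCompactSupport_deriv_deriv_fst hψ hψc).mul_left

/-- The second derivative of `quadTwoPhase` in the first variable. -/
def quadTwoPhaseDensity (m A B α β : ℝ) (p : ℝ × ℝ) : ℝ :=
  2 * m + α ^ 2 * twoPhaseDensity A B (α * p.1 + β * p.2)

theorem measurable_quadTwoPhaseDensity (m A B α β : ℝ) :
    Measurable (quadTwoPhaseDensity m A B α β) := by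
  have := measurable_twoPhaseDensity A B
  unfold quadTwoPhaseDensity
  fun_prop

theorem norm_quadTwoPhaseDensity_le (m A B α β : ℝ) (p : ℝ × ℝ) :
    ‖quadTwoPhaseDensity m A B α β p‖ ≤ ‖2 * m‖ + ‖α ^ 2‖ * (|A| + |B|) := by
  refine (norm_add_le _ _).trans ?_
  rw [norm_mul (α ^ 2)]
  gcongr
  exact norm_twoPhaseDensity_le _ _ _

theorem integrable_quadTwoPhaseDensity_mul (m A B α β : ℝ) {ψ : ℝ × ℝ → ℝ}
    (hψ : ContDiff ℝ 2 ψ) (hψc : HasCompactSupport ψ) :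
    Integrable fun p : ℝ × ℝ => quadTwoPhaseDensity m A B α β p * ψ p :=
  (hψ.continuous.integrable_of_hasCompactSupport hψc).bdd_mul
    (measurable_quadTwoPhaseDensity m A B α β).aestronglyMeasurable
    (Filter.Eventually.of_forall (norm_quadTwoPhaseDensity_le m A B α β))

theorem integral_quadTwoPhase_slice (m q A B α β y : ℝ) {φ : ℝ → ℝ}
    (hφ : ContDiff ℝ 2 φ) (hφc : HasCompactSupport φ) :
    ∫ x, quadTwoPhase m q A B α β (x, y) * deriv (deriv φ) x
      = ∫ x, quadTwoPhaseDensity m A B α β (x, y) * φ x := by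
  have hlin : ∀ x, HasDerivAt (fun x : ℝ => α * x + β * y) α x := fun x => by
    simpa using ((hasDerivAt_id x).const_mul α).add_const (β * y)
  refine integral_mul_deriv_deriv_of_off_countable
    (g := fun x => 2 * m * x + q * y + α * twoPhaseDeriv A B (α * x + β * y))
    (S := {x | α ≠ 0 ∧ α * x + β * y = 0}) ?_ ?_ ?_ ?_ ?_
    (fun x => norm_quadTwoPhaseDensity_le m A B α β (x, y)) hφ hφc
  · refine Set.Subsingleton.countable ?_
    rintro x ⟨hα, hx⟩ z ⟨-, hz⟩
    exact mul_left_cancel₀ hα (by linarith)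
  · intro x
    have h₁ := ((hasDerivAt_pow 2 x).const_mul m).add
      (((hasDerivAt_id x).mul_const y).const_mul q)
    have h₂ := (hasDerivAt_twoPhase A B (α * x + β * y)).comp x (hlin x)
    exact ((h₁.sub_const (m * y ^ 2)).add h₂).congr_deriv (by simp; ring)
  · have := continuous_twoPhaseDeriv A B
    fun_prop
  · intro x hx
    have h₀ : HasDerivAt (fun x : ℝ => 2 * m * x + q * y) (2 * m) x := by
      simpa using ((hasDerivAt_id x).const_mul (2 * m)).add_const (q * y)
    by_cases hα : α = 0
    · subst hα
      simpa [quadTwoPhaseDensity] using h₀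
    · have hs : α * x + β * y ≠ 0 := fun h => hx ⟨hα, h⟩
      have h₂ := ((hasDerivAt_twoPhaseDeriv A B hs).comp x (hlin x)).const_mul α
      exact (h₀.add h₂).congr_deriv (by simp only [quadTwoPhaseDensity]; ring)
  · have := measurable_quadTwoPhaseDensity m A B α β
    fun_prop

theorem integral_quadTwoPhase_mul_deriv_deriv_fst (m q A B α β : ℝ) {ψ : ℝ × ℝ → ℝ}
    (hψ : ContDiff ℝ 2 ψ) (hψc : HasCompactSupport ψ) :
    ∫ p : ℝ × ℝ, quadTwoPhase m q A B α β p * deriv (deriv (fun x => ψ (x, p.2))) p.1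
      = ∫ p : ℝ × ℝ, quadTwoPhaseDensity m A B α β p * ψ p := by
  rw [Measure.volume_eq_prod,
    integral_prod_symm _ (integrable_quadTwoPhase_mul_deriv_deriv_fst m q A B α β hψ hψc),
    integral_prod_symm _ (integrable_quadTwoPhaseDensity_mul m A B α β hψ hψc)]
  congr 1
  funext y
  have hemb : Topology.IsClosedEmbedding (fun x : ℝ => (x, y)) := by
    refine Topology.IsClosedEmbedding.of_continuous_injective_isClosedMap (by fun_prop)
      (fun x z h => (Prod.ext_iff.1 h).1) fun K hK => ?_
    have : (fun x : ℝ => (x, y)) '' K = K ×ˢ {y} := by ext ⟨u, v⟩; simp [eq_comm]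
    rw [this]
    exact hK.prod isClosed_singleton
  exact integral_quadTwoPhase_slice m q A B α β y
    (hψ.comp (contDiff_id.prodMk contDiff_const)) (hψc.comp_isClosedEmbedding hemb)

theorem quadTwoPhase_swap (m q A B α β : ℝ) (p : ℝ × ℝ) :
    quadTwoPhase (-m) q A B β α p.swap = quadTwoPhase m q A B α β p := by
  simp only [quadTwoPhase, Prod.fst_swap, Prod.snd_swap, add_comm (β * p.2)]
  ring

/-- The distributional Laplacian of `quadTwoPhase`. -/
theorem integral_quadTwoPhase_mul_lap2 (m q A B α β : ℝ) {ψ : ℝ × ℝ → ℝ}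
    (hψ : ContDiff ℝ 2 ψ) (hψc : HasCompactSupport ψ) :
    ∫ p, quadTwoPhase m q A B α β p * lap2 ψ p
      = ∫ p : ℝ × ℝ, (α ^ 2 + β ^ 2) * twoPhaseDensity A B (α * p.1 + β * p.2) * ψ p := by
  have hψs : ContDiff ℝ 2 (ψ ∘ Prod.swap) := hψ.comp (contDiff_snd.prodMk contDiff_fst)
  have hψsc : HasCompactSupport (ψ ∘ Prod.swap) :=
    hψc.comp_homeomorph (Homeomorph.prodComm ℝ ℝ)
  have hx := integral_quadTwoPhase_mul_deriv_deriv_fst m q A B α β hψ hψc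
  have hy := ((integral_prod_swap _).trans
    (integral_quadTwoPhase_mul_deriv_deriv_fst (-m) q A B β α hψs hψsc)).trans
      (integral_prod_swap _).symm
  have ix := integrable_quadTwoPhase_mul_deriv_deriv_fst m q A B α β hψ hψc
  have iy := (integrable_quadTwoPhase_mul_deriv_deriv_fst (-m) q A B β α hψs hψsc).swap
  have jx := integrable_quadTwoPhaseDensity_mul m A B α β hψ hψc
  have jy := (integrable_quadTwoPhaseDensity_mul (-m) A B β α hψs hψsc).swap
  have e₁ : ∀ p : ℝ × ℝ, quadTwoPhase m q A B α β p * lap2 ψ p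
      = quadTwoPhase m q A B α β p * deriv (deriv (fun x => ψ (x, p.2))) p.1
        + quadTwoPhase (-m) q A B β α p.swap
          * deriv (deriv (fun x => (ψ ∘ Prod.swap) (x, p.swap.2))) p.swap.1 := by
    intro p
    rw [quadTwoPhase_swap, lap2, mul_add]
    rfl
  have e₂ : ∀ p : ℝ × ℝ, (α ^ 2 + β ^ 2) * twoPhaseDensity A B (α * p.1 + β * p.2) * ψ p
      = quadTwoPhaseDensity m A B α β p * ψ p
        + quadTwoPhaseDensity (-m) A B β α p.swap * (ψ ∘ Prod.swap) p.swap := by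
    intro p
    simp only [quadTwoPhaseDensity, Prod.fst_swap, Prod.snd_swap, add_comm (β * p.2),
      Function.comp, Prod.swap_swap]
    ring
  rw [funext e₁, funext e₂]
  exact (integral_add ix iy).trans ((congrArg₂ (· + ·) hx hy).trans (integral_add jx jy).symm)

theorem lap2_eq_zero_of_notMem_tsupport {ψ : ℝ × ℝ → ℝ} {p : ℝ × ℝ} (hp : p ∉ tsupport ψ) :
    lap2 ψ p = 0 := by
  rw [notMem_tsupport_iff_eventuallyEq] at hp
  have h₁ : (fun x => ψ (x, p.2)) =ᶠ[nhds p.1] fun _ => 0 :=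
    (Continuous.tendsto (by fun_prop : Continuous fun x : ℝ => (x, p.2)) p.1).eventually hp
  have h₂ : (fun y => ψ (p.1, y)) =ᶠ[nhds p.2] fun _ => 0 :=
    (Continuous.tendsto (by fun_prop : Continuous fun y : ℝ => (p.1, y)) p.2).eventually hp
  rw [lap2, h₁.deriv.deriv_eq, h₂.deriv.deriv_eq]
  simp

/-- The two-phase equation with coefficients `μ`, `ν`, tested against `ψ`. -/
def TwoPhaseWeak (μ ν : ℝ) (v ψ : ℝ × ℝ → ℝ) : Prop :=
  ∫ p : ℝ × ℝ, v p * lap2 ψ p =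
    ∫ p : ℝ × ℝ, ({q | 0 < v q}.indicator (fun _ => μ) p
      - {q | v q < 0}.indicator (fun _ => ν) p) * ψ p

theorem TwoPhaseWeak.neg {μ ν : ℝ} {v ψ : ℝ × ℝ → ℝ} (h : TwoPhaseWeak μ ν v ψ) :
    TwoPhaseWeak ν μ (fun p => -v p) ψ := by
  unfold TwoPhaseWeak at h ⊢
  simp only [neg_mul, integral_neg, Left.neg_pos_iff, Left.neg_neg_iff]
  rw [h, ← integral_neg]
  congr 1
  funext p
  ring

/-- A function that coincides with a `quadTwoPhase` function near the support of `ψ`, with matching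
phases, solves the two-phase equation tested against `ψ`. -/
theorem twoPhaseWeak_of_eqOn {μ ν m q A B α β : ℝ} {v ψ : ℝ × ℝ → ℝ}
    (hψ : ContDiff ℝ 2 ψ) (hψc : HasCompactSupport ψ)
    (hμ : (α ^ 2 + β ^ 2) * A = μ) (hν : (α ^ 2 + β ^ 2) * B = ν)
    (hv : ∀ p ∈ tsupport ψ, v p = quadTwoPhase m q A B α β p)
    (hpos : ∀ p ∈ tsupport ψ, (0 < v p ↔ 0 < α * p.1 + β * p.2))
    (hneg : ∀ p ∈ tsupport ψ, (v p < 0 ↔ α * p.1 + β * p.2 < 0)) :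
    TwoPhaseWeak μ ν v ψ := by
  have e₁ : ∀ p, v p * lap2 ψ p = quadTwoPhase m q A B α β p * lap2 ψ p := by
    intro p
    by_cases hp : p ∈ tsupport ψ
    · rw [hv p hp]
    · rw [lap2_eq_zero_of_notMem_tsupport hp, mul_zero, mul_zero]
  rw [TwoPhaseWeak, funext e₁, integral_quadTwoPhase_mul_lap2 m q A B α β hψ hψc]
  congr 1
  funext p
  by_cases hp : p ∈ tsupport ψ
  · subst hμ hν
    simp only [Set.indicator_apply, Set.mem_ofPred_eq, hpos p hp, hneg p hp, twoPhaseDensity]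
    split_ifs with h₁ h₂
    · exact absurd h₁ h₂.not_gt
    all_goals ring
  · rw [image_eq_zero_of_notMem_tsupport hp, mul_zero, mul_zero]

theorem twoPhase_of_nonneg (A B : ℝ) {t : ℝ} (ht : 0 ≤ t) : twoPhase A B t = A / 2 * t ^ 2 := by
  rw [twoPhase, max_eq_left ht, max_eq_right (by linarith)]
  ring

theorem twoPhase_of_nonpos (A B : ℝ) {t : ℝ} (ht : t ≤ 0) :
    twoPhase A B t = -(B / 2 * t ^ 2) := by
  rw [twoPhase, max_eq_right ht, max_eq_left (by linarith)]
  ring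

/-- A point of the interior of the closure of `S` cannot be reached along a ray contained in an
open set disjoint from `S`. -/
theorem notMem_of_mem_interior_closure {S T : Set (ℝ × ℝ)} (hT : IsOpen T) (hST : Disjoint S T)
    {p : ℝ × ℝ} (hp : p ∈ interior (closure S)) (v : ℝ × ℝ) :
    ¬ ∀ ε : ℝ, 0 < ε → p + ε • v ∈ T := by
  intro h
  have hcont : Filter.Tendsto (fun ε : ℝ => p + ε • v) (nhds 0) (nhds p) := by
    have : Continuous fun ε : ℝ => p + ε • v := by fun_prop
    simpa using this.tendsto 0
  have hev : ∀ᶠ ε : ℝ in nhdsWithin 0 (Set.Ioi 0), p + ε • v ∈ closure S :=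
    (hcont.mono_left nhdsWithin_le_nhds).eventually (mem_interior_iff_mem_nhds.1 hp)
  obtain ⟨ε, hε, hpos⟩ := (hev.and self_mem_nhdsWithin).exists
  exact (hST.closure_left hT).le_bot ⟨hε, h ε hpos⟩

/-- The relations between the parameters `a = -c / l₁` and `b = c / l₂`. -/
structure TripleParam (l₁ l₂ l₃ a b : ℝ) : Prop where
  l₁_pos : 0 < l₁
  l₂_pos : 0 < l₂
  a_neg : a < 0
  b_pos : 0 < b
  l₁_mul_a : l₁ * a = -(l₂ * b)
  l₃_mul : l₃ * (l₁ + l₂) = l₁ * l₂ * (-(a * b) - 1)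

/-- The piece on the sector above both `y = 0` and `y = a x`. -/
def upperU (l₁ a : ℝ) (p : ℝ × ℝ) : ℝ :=
  if 0 ≤ p.2 ∧ a * p.1 ≤ p.2 then l₁ / 2 * (p.2 * (p.2 - a * p.1)) else 0

/-- The piece on the sector below both `y = 0` and `y = b x`. -/
def lowerU (l₂ b : ℝ) (p : ℝ × ℝ) : ℝ :=
  if p.2 ≤ 0 ∧ p.2 ≤ b * p.1 then -(l₂ / 2) * (p.2 * (b * p.1 - p.2)) else 0

/-- The piece on the sector between `y = b x` and `y = a x`. -/
def leftU (l₁ l₂ a b : ℝ) (p : ℝ × ℝ) : ℝ :=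
  if b * p.1 ≤ p.2 ∧ p.2 ≤ a * p.1 then
    l₁ * l₂ / (2 * (l₁ + l₂)) * ((a * p.1 - p.2) * (p.2 - b * p.1)) else 0

theorem upperU_pos_iff {l₁ a : ℝ} (h : 0 < l₁) (p : ℝ × ℝ) :
    0 < upperU l₁ a p ↔ 0 < p.2 ∧ a * p.1 < p.2 := by
  unfold upperU
  constructor
  · intro hp
    split_ifs at hp with hs
    · refine ⟨lt_of_le_of_ne hs.1 ?_, lt_of_le_of_ne hs.2 ?_⟩
      · intro h0; simp [← h0] at hp
      · intro h0; simp [← h0] at hp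
    · exact absurd hp (lt_irrefl 0)
  · rintro ⟨h1, h2⟩
    rw [if_pos ⟨h1.le, h2.le⟩]
    have := sub_pos.2 h2
    positivity

theorem lowerU_pos_iff {l₂ b : ℝ} (h : 0 < l₂) (p : ℝ × ℝ) :
    0 < lowerU l₂ b p ↔ p.2 < 0 ∧ p.2 < b * p.1 := by
  unfold lowerU
  constructor
  · intro hp
    split_ifs at hp with hs
    · refine ⟨lt_of_le_of_ne hs.1 ?_, lt_of_le_of_ne hs.2 ?_⟩
      · intro h0; simp [h0] at hp
      · intro h0; simp [← h0] at hp
    · exact absurd hp (lt_irrefl 0)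
  · rintro ⟨h1, h2⟩
    rw [if_pos ⟨h1.le, h2.le⟩]
    have := mul_pos (half_pos h) (mul_pos (neg_pos.2 h1) (sub_pos.2 h2))
    linarith

theorem leftU_pos_iff {l₁ l₂ a b : ℝ} (h₁ : 0 < l₁) (h₂ : 0 < l₂) (p : ℝ × ℝ) :
    0 < leftU l₁ l₂ a b p ↔ b * p.1 < p.2 ∧ p.2 < a * p.1 := by
  unfold leftU
  constructor
  · intro hp
    split_ifs at hp with hs
    · refine ⟨lt_of_le_of_ne hs.1 ?_, lt_of_le_of_ne hs.2 ?_⟩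
      · intro h0; simp [h0] at hp
      · intro h0; simp [h0] at hp
    · exact absurd hp (lt_irrefl 0)
  · rintro ⟨h1, h2⟩
    rw [if_pos ⟨h1.le, h2.le⟩]
    have := sub_pos.2 h1
    have := sub_pos.2 h2
    positivity

theorem upperU_nonneg {l₁ a : ℝ} (h : 0 < l₁) (p : ℝ × ℝ) : 0 ≤ upperU l₁ a p := by
  unfold upperU
  split_ifs with hs
  · have := hs.1
    have := sub_nonneg.2 hs.2
    positivity
  · exact le_rfl

theorem lowerU_nonneg {l₂ b : ℝ} (h : 0 < l₂) (p : ℝ × ℝ) : 0 ≤ lowerU l₂ b p := by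
  unfold lowerU
  split_ifs with hs
  · have := mul_nonneg (half_pos h).le (mul_nonneg (neg_nonneg.2 hs.1) (sub_nonneg.2 hs.2))
    linarith
  · exact le_rfl

theorem leftU_nonneg {l₁ l₂ a b : ℝ} (h₁ : 0 < l₁) (h₂ : 0 < l₂) (p : ℝ × ℝ) :
    0 ≤ leftU l₁ l₂ a b p := by
  unfold leftU
  split_ifs with hs
  · have := sub_nonneg.2 hs.1
    have := sub_nonneg.2 hs.2
    positivity
  · exact le_rfl

theorem sub_sign_iff {u w s : ℝ} (hu : 0 ≤ u) (hw : 0 ≤ w) (hus : 0 < u ↔ 0 < s)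
    (hws : 0 < w ↔ s < 0) : (0 < u - w ↔ 0 < s) ∧ (u - w < 0 ↔ s < 0) := by
  grind

theorem upperU_eq_zero {l₁ a : ℝ} (h : 0 < l₁) {p : ℝ × ℝ} (hp : ¬ (0 < p.2 ∧ a * p.1 < p.2)) :
    upperU l₁ a p = 0 :=
  le_antisymm (not_lt.1 (mt (upperU_pos_iff h p).1 hp)) (upperU_nonneg h p)

theorem lowerU_eq_zero {l₂ b : ℝ} (h : 0 < l₂) {p : ℝ × ℝ} (hp : ¬ (p.2 < 0 ∧ p.2 < b * p.1)) :
    lowerU l₂ b p = 0 :=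
  le_antisymm (not_lt.1 (mt (lowerU_pos_iff h p).1 hp)) (lowerU_nonneg h p)

theorem leftU_eq_zero {l₁ l₂ a b : ℝ} (h₁ : 0 < l₁) (h₂ : 0 < l₂) {p : ℝ × ℝ}
    (hp : ¬ (b * p.1 < p.2 ∧ p.2 < a * p.1)) : leftU l₁ l₂ a b p = 0 :=
  le_antisymm (not_lt.1 (mt (leftU_pos_iff h₁ h₂ p).1 hp)) (leftU_nonneg h₁ h₂ p)

namespace TripleParam

variable {l₁ l₂ l₃ a b : ℝ} {ψ : ℝ × ℝ → ℝ}

theorem upper_sub_lower (P : TripleParam l₁ l₂ l₃ a b) (hψ : ContDiff ℝ 2 ψ)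
    (hψc : HasCompactSupport ψ)
    (hsupp : ∀ p ∈ tsupport ψ, ¬ (b * p.1 ≤ p.2 ∧ p.2 ≤ a * p.1)) :
    TwoPhaseWeak l₁ l₂ (fun p => upperU l₁ a p - lowerU l₂ b p) ψ := by
  obtain ⟨h₁, h₂, ha, hb, hab, -⟩ := P
  have key : ∀ p ∈ tsupport ψ, (0 < upperU l₁ a p ↔ 0 < 0 * p.1 + 1 * p.2) ∧
      (0 < lowerU l₂ b p ↔ 0 * p.1 + 1 * p.2 < 0) := by
    rintro ⟨x, y⟩ hp
    have hs := hsupp _ hp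
    rw [upperU_pos_iff h₁, lowerU_pos_iff h₂]
    simp only [zero_mul, one_mul, zero_add, and_iff_left_iff_imp, not_and, not_le] at hs ⊢
    constructor
    · intro hy
      rcases le_or_gt x 0 with hx | hx
      · exact hs (by nlinarith)
      · nlinarith
    · intro hy
      rcases le_or_gt x 0 with hx | hx
      · by_contra! hyb
        nlinarith [hs hyb]
      · nlinarith
  refine twoPhaseWeak_of_eqOn (m := 0) (q := -(l₁ * a) / 2) (A := l₁) (B := l₂) (α := 0) (β := 1)
    hψ hψc (by ring) (by ring) ?_
    (fun p hp => (sub_sign_iff (upperU_nonneg h₁ p) (lowerU_nonneg h₂ p)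
      (key p hp).1 (key p hp).2).1)
    (fun p hp => (sub_sign_iff (upperU_nonneg h₁ p) (lowerU_nonneg h₂ p)
      (key p hp).1 (key p hp).2).2)
  rintro ⟨x, y⟩ hp
  have hs := hsupp _ hp
  simp only at hs ⊢
  rw [quadTwoPhase]
  rcases le_or_gt 0 y with hy | hy
  · have hya : a * x ≤ y := by
      rcases le_or_gt x 0 with hx | hx
      · by_contra! hyb
        exact hs ⟨by nlinarith, hyb.le⟩
      · nlinarith
    rw [lowerU_eq_zero h₂ (fun h => absurd h.1 hy.not_gt),
      twoPhase_of_nonneg _ _ (by simpa using hy),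
      upperU, if_pos ⟨hy, hya⟩]
    ring
  · have hyb := ((lowerU_pos_iff h₂ _).1 ((key _ hp).2.2 (by simpa using hy))).2
    rw [upperU_eq_zero h₁ (fun h => absurd h.1 hy.not_gt),
      twoPhase_of_nonpos _ _ (by simpa using hy.le),
      lowerU, if_pos ⟨hy.le, hyb.le⟩, hab]
    ring

theorem upper_sub_left (P : TripleParam l₁ l₂ l₃ a b) (hψ : ContDiff ℝ 2 ψ)
    (hψc : HasCompactSupport ψ)
    (hsupp : ∀ p ∈ tsupport ψ, ¬ (p.2 ≤ 0 ∧ p.2 ≤ b * p.1)) :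
    TwoPhaseWeak l₁ l₃ (fun p => upperU l₁ a p - leftU l₁ l₂ a b p) ψ := by
  obtain ⟨h₁, h₂, ha, hb, hab, h₃⟩ := P
  have key : ∀ p ∈ tsupport ψ, (0 < upperU l₁ a p ↔ 0 < -a * p.1 + 1 * p.2) ∧
      (0 < leftU l₁ l₂ a b p ↔ -a * p.1 + 1 * p.2 < 0) := by
    rintro ⟨x, y⟩ hp
    have hs := hsupp _ hp
    rw [upperU_pos_iff h₁, leftU_pos_iff h₁ h₂]
    simp only [not_and, not_le] at hs ⊢
    refine ⟨⟨fun h => by linarith [h.2], fun h => ⟨?_, by linarith⟩⟩,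
      ⟨fun h => by linarith [h.2], fun h => ⟨?_, by linarith⟩⟩⟩
    · by_contra! hy
      have := hs hy
      rcases le_or_gt x 0 with hx | hx <;> nlinarith
    · rcases le_or_gt y 0 with hy | hy
      · exact hs hy
      · rcases le_or_gt x 0 with hx | hx <;> nlinarith
  have ha2 : 1 + a ^ 2 ≠ 0 := by positivity
  refine twoPhaseWeak_of_eqOn (m := -(l₁ * a ^ 2) / (2 * (1 + a ^ 2)))
    (q := -(l₁ * a) / 2 + l₁ * a / (1 + a ^ 2)) (A := l₁ / (1 + a ^ 2)) (B := l₃ / (1 + a ^ 2))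
    (α := -a) (β := 1)
    hψ hψc (by field_simp; ring) (by field_simp; ring) ?_
    (fun p hp => (sub_sign_iff (upperU_nonneg h₁ p) (leftU_nonneg h₁ h₂ p)
      (key p hp).1 (key p hp).2).1)
    (fun p hp => (sub_sign_iff (upperU_nonneg h₁ p) (leftU_nonneg h₁ h₂ p)
      (key p hp).1 (key p hp).2).2)
  rintro ⟨x, y⟩ hp
  have hs := hsupp _ hp
  simp only [not_and, not_le] at hs ⊢
  rw [quadTwoPhase]
  rcases le_or_gt 0 (-a * x + 1 * y) with hy | hy
  · have hy0 : 0 ≤ y := by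
      by_contra! hy0
      have := hs hy0.le
      rcases le_or_gt x 0 with hx | hx <;> nlinarith
    rw [leftU_eq_zero h₁ h₂ (fun h => by linarith [h.2]), twoPhase_of_nonneg _ _ hy,
      upperU, if_pos ⟨hy0, by linarith⟩]
    field_simp
    ring
  · have hyb := (leftU_pos_iff h₁ h₂ _).1 ((key _ hp).2.2 hy)
    rw [upperU_eq_zero h₁ (fun h => by linarith [h.2]), twoPhase_of_nonpos _ _ hy.le,
      leftU, if_pos ⟨hyb.1.le, hyb.2.le⟩]
    have hb' : b = -(l₁ * a) / l₂ := by field_simp; linarith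
    have h₃' : l₃ = l₁ * l₂ * (-(a * b) - 1) / (l₁ + l₂) := by field_simp; linarith
    rw [h₃', hb']
    field_simp
    ring

theorem lower_sub_left (P : TripleParam l₁ l₂ l₃ a b) (hψ : ContDiff ℝ 2 ψ)
    (hψc : HasCompactSupport ψ)
    (hsupp : ∀ p ∈ tsupport ψ, ¬ (0 ≤ p.2 ∧ a * p.1 ≤ p.2)) :
    TwoPhaseWeak l₂ l₃ (fun p => lowerU l₂ b p - leftU l₁ l₂ a b p) ψ := by
  obtain ⟨h₁, h₂, ha, hb, hab, h₃⟩ := P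
  have key : ∀ p ∈ tsupport ψ, (0 < lowerU l₂ b p ↔ 0 < b * p.1 + -1 * p.2) ∧
      (0 < leftU l₁ l₂ a b p ↔ b * p.1 + -1 * p.2 < 0) := by
    rintro ⟨x, y⟩ hp
    have hs := hsupp _ hp
    rw [lowerU_pos_iff h₂, leftU_pos_iff h₁ h₂]
    simp only [not_and, not_le] at hs ⊢
    refine ⟨⟨fun h => by linarith [h.2], fun h => ⟨?_, by linarith⟩⟩,
      ⟨fun h => by linarith [h.1], fun h => ⟨by linarith, ?_⟩⟩⟩
    · by_contra! hy
      have := hs hy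
      rcases le_or_gt x 0 with hx | hx <;> nlinarith
    · rcases le_or_gt 0 y with hy | hy
      · exact hs hy
      · rcases le_or_gt x 0 with hx | hx <;> nlinarith
  have hb2 : 1 + b ^ 2 ≠ 0 := by positivity
  refine twoPhaseWeak_of_eqOn (m := -(l₂ * b ^ 2) / (2 * (1 + b ^ 2)))
    (q := -(l₂ * b) / 2 + l₂ * b / (1 + b ^ 2)) (A := l₂ / (1 + b ^ 2)) (B := l₃ / (1 + b ^ 2))
    (α := b) (β := -1)
    hψ hψc (by field_simp; ring) (by field_simp; ring) ?_
    (fun p hp => (sub_sign_iff (lowerU_nonneg h₂ p) (leftU_nonneg h₁ h₂ p)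
      (key p hp).1 (key p hp).2).1)
    (fun p hp => (sub_sign_iff (lowerU_nonneg h₂ p) (leftU_nonneg h₁ h₂ p)
      (key p hp).1 (key p hp).2).2)
  rintro ⟨x, y⟩ hp
  have hs := hsupp _ hp
  simp only [not_and, not_le] at hs ⊢
  rw [quadTwoPhase]
  rcases le_or_gt 0 (b * x + -1 * y) with hy | hy
  · have hy0 : y ≤ 0 := by
      by_contra! hy0
      have := hs hy0.le
      rcases le_or_gt x 0 with hx | hx <;> nlinarith
    rw [leftU_eq_zero h₁ h₂ (fun h => by linarith [h.1]), twoPhase_of_nonneg _ _ hy,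
      lowerU, if_pos ⟨hy0, by linarith⟩]
    field_simp
    ring
  · have hyb := (leftU_pos_iff h₁ h₂ _).1 ((key _ hp).2.2 hy)
    rw [lowerU_eq_zero h₂ (fun h => by linarith [h.2]), twoPhase_of_nonpos _ _ hy.le,
      leftU, if_pos ⟨hyb.1.le, hyb.2.le⟩]
    have ha' : a = -(l₂ * b) / l₁ := by field_simp; linarith
    have h₃' : l₃ = l₁ * l₂ * (-(a * b) - 1) / (l₁ + l₂) := by field_simp; linarith
    rw [h₃', ha']
    field_simp
    ring

theorem not_left_of_mem_interior (P : TripleParam l₁ l₂ l₃ a b) {p : ℝ × ℝ}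
    (hp : p ∈ interior (closure ({p | 0 < upperU l₁ a p} ∪ {p | 0 < lowerU l₂ b p}))) :
    ¬ (b * p.1 ≤ p.2 ∧ p.2 ≤ a * p.1) := by
  obtain ⟨h₁, h₂, ha, hb, -, -⟩ := P
  intro h
  refine notMem_of_mem_interior_closure (T := {p | b * p.1 < p.2 ∧ p.2 < a * p.1})
    (IsOpen.and (isOpen_lt (by fun_prop) (by fun_prop)) (isOpen_lt (by fun_prop) (by fun_prop)))
    ?_ hp (-1, 0) ?_
  · rw [Set.disjoint_left]
    rintro ⟨x, y⟩ hu ⟨hl, hr⟩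
    simp only [Set.mem_union, Set.mem_ofPred_eq, upperU_pos_iff h₁, lowerU_pos_iff h₂] at hu hl hr
    rcases hu with hu | hu <;> linarith [hu.2]
  · intro ε hε
    simp only [Set.mem_ofPred_eq, Prod.fst_add, Prod.snd_add, Prod.smul_fst, Prod.smul_snd,
      smul_eq_mul]
    constructor <;> nlinarith [h.1, h.2]

theorem not_lower_of_mem_interior (P : TripleParam l₁ l₂ l₃ a b) {p : ℝ × ℝ}
    (hp : p ∈ interior (closure ({p | 0 < upperU l₁ a p} ∪ {p | 0 < leftU l₁ l₂ a b p}))) :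
    ¬ (p.2 ≤ 0 ∧ p.2 ≤ b * p.1) := by
  obtain ⟨h₁, h₂, ha, hb, -, -⟩ := P
  intro h
  refine notMem_of_mem_interior_closure (T := {p | p.2 < 0 ∧ p.2 < b * p.1})
    (IsOpen.and (isOpen_lt (by fun_prop) (by fun_prop)) (isOpen_lt (by fun_prop) (by fun_prop)))
    ?_ hp (0, -1) ?_
  · rw [Set.disjoint_left]
    rintro ⟨x, y⟩ hu ⟨hl, hr⟩
    simp only [Set.mem_union, Set.mem_ofPred_eq, upperU_pos_iff h₁, leftU_pos_iff h₁ h₂]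
      at hu hl hr
    rcases hu with hu | hu <;> linarith [hu.1]
  · intro ε hε
    simp only [Set.mem_ofPred_eq, Prod.fst_add, Prod.snd_add, Prod.smul_fst, Prod.smul_snd,
      smul_eq_mul]
    constructor <;> nlinarith [h.1, h.2]

theorem not_upper_of_mem_interior (P : TripleParam l₁ l₂ l₃ a b) {p : ℝ × ℝ}
    (hp : p ∈ interior (closure ({p | 0 < lowerU l₂ b p} ∪ {p | 0 < leftU l₁ l₂ a b p}))) :
    ¬ (0 ≤ p.2 ∧ a * p.1 ≤ p.2) := by
  obtain ⟨h₁, h₂, ha, hb, -, -⟩ := P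
  intro h
  refine notMem_of_mem_interior_closure (T := {p | 0 < p.2 ∧ a * p.1 < p.2})
    (IsOpen.and (isOpen_lt (by fun_prop) (by fun_prop)) (isOpen_lt (by fun_prop) (by fun_prop)))
    ?_ hp (0, 1) ?_
  · rw [Set.disjoint_left]
    rintro ⟨x, y⟩ hu ⟨hl, hr⟩
    simp only [Set.mem_union, Set.mem_ofPred_eq, lowerU_pos_iff h₂, leftU_pos_iff h₁ h₂]
      at hu hl hr
    rcases hu with hu | hu
    · linarith [hu.1]
    · linarith [hu.2]
  · intro ε hε
    simp only [Set.mem_ofPred_eq, Prod.fst_add, Prod.snd_add, Prod.smul_fst, Prod.smul_snd,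
      smul_eq_mul]
    constructor <;> nlinarith [h.1, h.2]

end TripleParam

theorem tripleParam_of_pos {l₁ l₂ l₃ : ℝ} (h₁ : 0 < l₁) (h₂ : 0 < l₂) (h₃ : 0 < l₃) :
    TripleParam l₁ l₂ l₃ (-√(l₁ * l₂ + l₁ * l₃ + l₂ * l₃) / l₁)
      (√(l₁ * l₂ + l₁ * l₃ + l₂ * l₃) / l₂) := by
  have hd : 0 < l₁ * l₂ + l₁ * l₃ + l₂ * l₃ := by positivity
  have hc := Real.sqrt_pos.2 hd
  have hsq := Real.sq_sqrt hd.le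
  set c := √(l₁ * l₂ + l₁ * l₃ + l₂ * l₃)
  refine ⟨h₁, h₂, div_neg_of_neg_of_pos (neg_neg_of_pos hc) h₁, div_pos hc h₂, ?_, ?_⟩
  · field_simp
  · field_simp
    rw [hsq]
    ring

/-- in the three-phase null QD example, for each pair `i ≠ j` the
difference `u_{ij} = uᵢ − uⱼ` satisfies, in the sense of distributions in the interior of
the closure of `Ωᵢ ∪ Ωⱼ` (where `Ωᵢ = {uᵢ > 0}`), the two-phase equation
`Δu_{ij} = λᵢ χ_{u_{ij}>0} − λⱼ χ_{u_{ij}<0}`. -/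
theorem stmt15 (l₁ l₂ l₃ : ℝ) (h₁ : 0 < l₁) (h₂ : 0 < l₂) (h₃ : 0 < l₃)
    (i j : Fin 3) (hij : i ≠ j)
    (ψ : ℝ × ℝ → ℝ) (hψsm : ContDiff ℝ (⊤ : ℕ∞) ψ) (hψc : HasCompactSupport ψ)
    (hψsupp : tsupport ψ ⊆ interior (closure
      ({p | 0 < tripleU l₁ l₂ l₃ i p} ∪ {p | 0 < tripleU l₁ l₂ l₃ j p}))) :
    ∫ p : ℝ × ℝ, (tripleU l₁ l₂ l₃ i p - tripleU l₁ l₂ l₃ j p) * lap2 ψ p =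
      ∫ p : ℝ × ℝ,
        (({q | 0 < tripleU l₁ l₂ l₃ i q - tripleU l₁ l₂ l₃ j q}.indicator
            (fun _ => ![l₁, l₂, l₃] i) p)
          - ({q | tripleU l₁ l₂ l₃ i q - tripleU l₁ l₂ l₃ j q < 0}.indicator
            (fun _ => ![l₁, l₂, l₃] j) p)) * ψ p := by
  have P := tripleParam_of_pos h₁ h₂ h₃
  have hψ : ContDiff ℝ 2 ψ := contDiff_infty.1 hψsm 2
  have e₀ : tripleU l₁ l₂ l₃ 0 = upperU l₁ (-√(l₁ * l₂ + l₁ * l₃ + l₂ * l₃) / l₁) := rfl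
  have e₁ : tripleU l₁ l₂ l₃ 1 = lowerU l₂ (√(l₁ * l₂ + l₁ * l₃ + l₂ * l₃) / l₂) := rfl
  have e₂ : tripleU l₁ l₂ l₃ 2 = leftU l₁ l₂ (-√(l₁ * l₂ + l₁ * l₃ + l₂ * l₃) / l₁)
    (√(l₁ * l₂ + l₁ * l₃ + l₂ * l₃) / l₂) := rfl
  have main : ∀ i j : Fin 3, i < j →
      tsupport ψ ⊆ interior (closure
        ({p | 0 < tripleU l₁ l₂ l₃ i p} ∪ {p | 0 < tripleU l₁ l₂ l₃ j p})) →
      TwoPhaseWeak (![l₁, l₂, l₃] i) (![l₁, l₂, l₃] j)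
        (fun p => tripleU l₁ l₂ l₃ i p - tripleU l₁ l₂ l₃ j p) ψ := by
    intro i j hij hsupp
    obtain ⟨rfl, rfl⟩ | ⟨rfl, rfl⟩ | ⟨rfl, rfl⟩ :
        (i = 0 ∧ j = 1) ∨ (i = 0 ∧ j = 2) ∨ (i = 1 ∧ j = 2) := by omega
    · rw [e₀, e₁] at hsupp ⊢
      exact P.upper_sub_lower hψ hψc fun p hp => P.not_left_of_mem_interior (hsupp hp)
    · rw [e₀, e₂] at hsupp ⊢
      exact P.upper_sub_left hψ hψc fun p hp => P.not_lower_of_mem_interior (hsupp hp)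
    · rw [e₁, e₂] at hsupp ⊢
      exact P.lower_sub_left hψ hψc fun p hp => P.not_upper_of_mem_interior (hsupp hp)
  rcases lt_or_gt_of_ne hij with h | h
  · exact main i j h hψsupp
  · rw [Set.union_comm] at hψsupp
    have := (main j i h hψsupp).neg
    simp only [neg_sub] at this
    exact this
end
end

section
/- Let D = {(x,y) : 0 < x < 2, |y| < (1 − (x−1)²)/2} ⊂ ℝ², and let μ be the measure on the segment [0,2] × {0} with density dμ = 2(1 − √|x−1|) dx. Then ∫_D h(x,y) dx dy = ∫₀² h(x,0)·2(1 − √|x−1|) dx for every integrable harmonic function h on D. -/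
open MeasureTheory Set

noncomputable section

/-- The domain `D = {(x,y) : 0 < x < 2, |y| < (1 − (x−1)²)/2}`. -/
def domD : Set (ℝ × ℝ) :=
  {p | 0 < p.1 ∧ p.1 < 2 ∧ |p.2| < (1 - (p.1 - 1) ^ 2) / 2}

/-- The open triangle with vertices `(0,0)`, `(1,0)`, `(0,1)`. -/
def openTriangle : Set (ℝ × ℝ) := {z | 0 < z.1 ∧ 0 < z.2 ∧ z.1 + z.2 < 1}

/-- The closed triangle with vertices `(0,0)`, `(1,0)`, `(0,1)`. -/
def closedTriangle : Set (ℝ × ℝ) := {z | 0 ≤ z.1 ∧ 0 ≤ z.2 ∧ z.1 + z.2 ≤ 1}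

lemma isOpen_openTriangle : IsOpen openTriangle :=
  (isOpen_lt continuous_const continuous_fst).inter
    ((isOpen_lt continuous_const continuous_snd).inter
      (isOpen_lt (continuous_fst.add continuous_snd) continuous_const))

lemma isCompact_closedTriangle : IsCompact closedTriangle := by
  have hcl : IsClosed closedTriangle :=
    (isClosed_le continuous_const continuous_fst).inter
      ((isClosed_le continuous_const continuous_snd).inter
        (isClosed_le (continuous_fst.add continuous_snd) continuous_const))
  refine (isCompact_Icc (a := ((0 : ℝ), (0 : ℝ))) (b := (1, 1))).of_isClosed_subset hcl ?_
  rintro ⟨p, q⟩ ⟨hp, hq, hpq⟩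
  simp only at hp hq hpq
  exact ⟨⟨hp, hq⟩, ⟨by simp only; linarith, by simp only; linarith⟩⟩

lemma openTriangle_subset_closedTriangle : openTriangle ⊆ closedTriangle :=
  fun _ hz => ⟨hz.1.le, hz.2.1.le, hz.2.2.le⟩

lemma integrableOn_openTriangle {f : ℝ × ℝ → ℝ} (hf : ContinuousOn f closedTriangle) :
    IntegrableOn f openTriangle :=
  (hf.integrableOn_compact isCompact_closedTriangle).mono_set openTriangle_subset_closedTriangle

lemma setIntegral_openTriangle {f : ℝ × ℝ → ℝ} (hf : IntegrableOn f openTriangle) :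
    ∫ z in openTriangle, f z = ∫ p in (0 : ℝ)..1, ∫ q in (0 : ℝ)..(1 - p), f (p, q) := by
  have hm := isOpen_openTriangle.measurableSet
  rw [← integral_indicator hm, Measure.volume_eq_prod,
    integral_prod _ ((integrable_indicator_iff hm).2 hf),
    intervalIntegral.integral_of_le zero_le_one, integral_Ioc_eq_integral_Ioo,
    ← integral_indicator measurableSet_Ioo]
  congr 1 with p
  by_cases hp : p ∈ Ioo (0 : ℝ) 1
  · rw [indicator_of_mem hp, intervalIntegral.integral_of_le (by linarith [hp.2]),
      integral_Ioc_eq_integral_Ioo, ← integral_indicator measurableSet_Ioo]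
    congr 1 with q
    by_cases hq : q ∈ Ioo 0 (1 - p)
    · rw [indicator_of_mem hq, indicator_of_mem]
      exact ⟨hp.1, hq.1, by simp only; linarith [hq.2]⟩
    · rw [indicator_of_notMem hq, indicator_of_notMem]
      rintro ⟨h1, h2, h3⟩
      simp only at h1 h2 h3
      exact hq ⟨h2, by linarith⟩
  · rw [indicator_of_notMem hp]
    refine integral_eq_zero_of_ae (Filter.Eventually.of_forall fun q => ?_)
    refine indicator_of_notMem ?_ _
    rintro ⟨h1, h2, h3⟩
    simp only at h1 h2 h3
    exact hp ⟨h1, by linarith⟩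

lemma setIntegral_openTriangle_deriv_snd {G G' : ℝ × ℝ → ℝ}
    (hG : ∀ z ∈ closedTriangle, HasDerivAt (fun t => G (z.1, t)) (G' z) z.2)
    (hG' : ContinuousOn G' closedTriangle) (h0 : ∀ p, G (p, 1 - p) = 0) :
    ∫ z in openTriangle, G' z = -∫ p in (0 : ℝ)..1, G (p, 0) := by
  rw [setIntegral_openTriangle (integrableOn_openTriangle hG'), ← intervalIntegral.integral_neg]
  refine intervalIntegral.integral_congr fun p hp => ?_
  rw [uIcc_of_le zero_le_one] at hp
  have hle : (0 : ℝ) ≤ 1 - p := by linarith [hp.2]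
  have hmem : ∀ q ∈ uIcc 0 (1 - p), (p, q) ∈ closedTriangle := by
    intro q hq
    rw [uIcc_of_le hle] at hq
    exact ⟨hp.1, hq.1, by simp only; linarith [hq.2]⟩
  rw [intervalIntegral.integral_eq_sub_of_hasDerivAt (f := fun t => G (p, t))
    (fun q hq => hG _ (hmem q hq)), h0, zero_sub]
  exact (hG'.comp (by fun_prop) hmem).intervalIntegrable

lemma setIntegral_openTriangle_swap (f : ℝ × ℝ → ℝ) :
    ∫ z in openTriangle, f z = ∫ z in openTriangle, f z.swap := by
  have h := (Measure.measurePreserving_swap (μ := (volume : Measure ℝ))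
    (ν := (volume : Measure ℝ))).setIntegral_preimage_emb
      MeasurableEquiv.prodComm.measurableEmbedding f openTriangle
  rw [← Measure.volume_eq_prod] at h
  rw [← h]
  congr 2
  ext z
  exact ⟨fun hz => ⟨hz.2.1, hz.1, by simpa [add_comm] using hz.2.2⟩,
    fun hz => ⟨hz.2.1, hz.1, by simpa [add_comm] using hz.2.2⟩⟩

lemma setIntegral_openTriangle_deriv_fst {F F' : ℝ × ℝ → ℝ}
    (hF : ∀ z ∈ closedTriangle, HasDerivAt (fun t => F (t, z.2)) (F' z) z.1)
    (hF' : ContinuousOn F' closedTriangle) (h0 : ∀ q, F (1 - q, q) = 0) :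
    ∫ z in openTriangle, F' z = -∫ q in (0 : ℝ)..1, F (0, q) := by
  have hsw : ∀ z ∈ closedTriangle, z.swap ∈ closedTriangle := fun z hz =>
    ⟨hz.2.1, hz.1, by simpa [add_comm] using hz.2.2⟩
  rw [setIntegral_openTriangle_swap]
  exact setIntegral_openTriangle_deriv_snd (G := fun z => F z.swap) (G' := fun z => F' z.swap)
    (fun z hz => hF _ (hsw z hz)) (hF'.comp continuous_swap.continuousOn hsw) h0

/-- The map `ζ ↦ 1 + ζ²` in real coordinates. -/
def parabolicMap (z : ℝ × ℝ) : ℝ × ℝ := (1 + z.1 ^ 2 - z.2 ^ 2, 2 * z.1 * z.2)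

lemma continuous_parabolicMap : Continuous parabolicMap := by
  unfold parabolicMap; fun_prop

lemma injOn_parabolicMap : InjOn parabolicMap openTriangle := by
  rintro ⟨p, q⟩ ⟨hp, hq, -⟩ ⟨p', q'⟩ ⟨hp', hq', -⟩ h
  simp only [parabolicMap, Prod.mk.injEq] at h hp hq hp' hq' ⊢
  obtain ⟨h1, h2⟩ := h
  have h3 : p ^ 2 - q ^ 2 = p' ^ 2 - q' ^ 2 := by linarith
  have h4 : p * q = p' * q' := by linarith
  have h5 : p ^ 2 + q ^ 2 = p' ^ 2 + q' ^ 2 := by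
    refine (sq_eq_sq₀ (by positivity) (by positivity)).1 ?_
    linear_combination (p ^ 2 - q ^ 2 + p' ^ 2 - q' ^ 2) * h3 + 4 * (p * q + p' * q') * h4
  exact ⟨(sq_eq_sq₀ hp.le hp'.le).1 (by linarith), (sq_eq_sq₀ hq.le hq'.le).1 (by linarith)⟩

lemma parabolicMap_image_openTriangle :
    parabolicMap '' openTriangle = domD ∩ {z | 0 < z.2} := by
  ext ⟨x, y⟩
  constructor
  · rintro ⟨⟨p, q⟩, ⟨hp, hq, hpq⟩, h⟩
    simp only [parabolicMap, Prod.mk.injEq] at h hp hq hpq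
    obtain ⟨rfl, rfl⟩ := h
    have hy : 0 < 2 * p * q := by positivity
    refine ⟨⟨?_, ?_, ?_⟩, hy⟩ <;> simp only
    · nlinarith
    · nlinarith
    · rw [abs_of_pos hy]
      have hs : (p + q) ^ 2 < 1 := by nlinarith
      have : (1 + p ^ 2 - q ^ 2 - 1) ^ 2 = (p - q) ^ 2 * (p + q) ^ 2 := by ring
      nlinarith [mul_nonneg (sq_nonneg (p - q)) (sub_nonneg.2 hs.le)]
  · rintro ⟨⟨-, -, h3⟩, hy⟩
    simp only [mem_ofPred_eq] at h3 hy
    rw [abs_of_pos hy] at h3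
    obtain ⟨u, rfl⟩ : ∃ u, x = 1 + u := ⟨x - 1, by ring⟩
    rw [add_sub_cancel_left] at h3
    set r := √(u ^ 2 + y ^ 2) with hr
    have hr2 : r ^ 2 = u ^ 2 + y ^ 2 := Real.sq_sqrt (by positivity)
    have hr0 : 0 ≤ r := Real.sqrt_nonneg _
    have hur : |u| < r := by
      refine abs_lt_of_sq_lt_sq ?_ hr0
      nlinarith
    obtain ⟨hu1, hu2⟩ := abs_lt.1 hur
    have hp2 : √((r + u) / 2) ^ 2 = (r + u) / 2 := Real.sq_sqrt (by linarith)
    have hq2 : √((r - u) / 2) ^ 2 = (r - u) / 2 := Real.sq_sqrt (by linarith)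
    have hp : 0 < √((r + u) / 2) := Real.sqrt_pos.2 (by linarith)
    have hq : 0 < √((r - u) / 2) := Real.sqrt_pos.2 (by linarith)
    set p := √((r + u) / 2)
    set q := √((r - u) / 2)
    have hpq : 2 * p * q = y := by
      refine (sq_eq_sq₀ (by positivity) hy.le).1 ?_
      have : (2 * p * q) ^ 2 = 4 * p ^ 2 * q ^ 2 := by ring
      rw [this, hp2, hq2]
      linarith
    refine ⟨(p, q), ⟨hp, hq, ?_⟩, ?_⟩
    · have hr1 : r < 1 - y := by
        refine lt_of_pow_lt_pow_left₀ 2 (by nlinarith) ?_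
        nlinarith
      simp only
      nlinarith
    · simp only [parabolicMap, Prod.mk.injEq]
      exact ⟨by linarith, hpq⟩

lemma mem_closure_domD {x y : ℝ} (hx : |x - 1| ≤ 1) (hy : |y| ≤ (1 - (x - 1) ^ 2) / 2) :
    (x, y) ∈ closure domD := by
  have hc : Continuous fun t : ℝ => ((1 + t * (x - 1), t * y) : ℝ × ℝ) := by fun_prop
  have h1 : (1 : ℝ) ∈ closure (Ico (0 : ℝ) 1) := by
    rw [closure_Ico zero_ne_one]; exact right_mem_Icc.2 zero_le_one
  have := map_mem_closure hc h1 (t := domD) ?_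
  · simpa using this
  rintro t ⟨ht0, ht1⟩
  obtain ⟨hx1, hx2⟩ := abs_le.1 hx
  refine ⟨?_, ?_, ?_⟩ <;> simp only
  · nlinarith
  · nlinarith
  · rw [abs_mul, abs_of_nonneg ht0, add_sub_cancel_left, mul_pow]
    have hsq : (x - 1) ^ 2 ≤ 1 := by nlinarith
    nlinarith [mul_le_mul_of_nonneg_left hy ht0, mul_nonneg ht0 (sub_nonneg.2 ht1.le),
      mul_nonneg (mul_nonneg ht0 (sub_nonneg.2 ht1.le)) (sq_nonneg (x - 1))]

lemma parabolicMap_mem_closure_domD {z : ℝ × ℝ} (hz : z ∈ closedTriangle) :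
    parabolicMap z ∈ closure domD := by
  obtain ⟨p, q⟩ := z
  obtain ⟨hp, hq, hpq⟩ := hz
  simp only at hp hq hpq
  have hs : (p + q) ^ 2 ≤ 1 := by nlinarith
  refine mem_closure_domD (abs_le.2 ⟨by nlinarith, by nlinarith⟩) ?_
  rw [abs_of_nonneg (by positivity)]
  have : (1 + p ^ 2 - q ^ 2 - 1) ^ 2 = (p - q) ^ 2 * (p + q) ^ 2 := by ring
  nlinarith [mul_nonneg (sq_nonneg (p - q)) (sub_nonneg.2 hs)]

lemma setIntegral_parabolicMap (h : ℝ × ℝ → ℝ) :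
    ∫ z in domD ∩ {z | 0 < z.2}, h z =
      ∫ z in openTriangle, 4 * (z.1 ^ 2 + z.2 ^ 2) * h (parabolicMap z) := by
  let A : ℝ × ℝ → ℝ × ℝ →L[ℝ] ℝ × ℝ := fun z =>
    (Matrix.toLin (.finTwoProd ℝ) (.finTwoProd ℝ)
      !![2 * z.1, -2 * z.2; 2 * z.2, 2 * z.1]).toContinuousLinearMap
  have hA : ∀ z, HasFDerivAt parabolicMap (A z) z := by
    intro z
    simp only [A]
    rw [Matrix.toLin_finTwoProd_toContinuousLinearMap]
    refine HasFDerivAt.prodMk (𝕜 := ℝ) ?_ ?_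
    · refine (((hasFDerivAt_fst (𝕜 := ℝ) (p := z)).pow 2).const_add 1 |>.sub
        ((hasFDerivAt_snd (𝕜 := ℝ) (p := z)).pow 2)).congr_fderiv ?_
      ext <;> simp
    · refine (((hasFDerivAt_fst (𝕜 := ℝ) (p := z)).const_mul 2).mul
        (hasFDerivAt_snd (𝕜 := ℝ) (p := z))).congr_fderiv ?_
      ext <;> simp [mul_comm]
  have hdet : ∀ z, (A z).det = 4 * (z.1 ^ 2 + z.2 ^ 2) := by
    intro z
    simp only [A, LinearMap.det_toContinuousLinearMap, LinearMap.det_toLin,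
      Matrix.det_fin_two_of]
    ring
  rw [← parabolicMap_image_openTriangle, integral_image_eq_integral_abs_det_fderiv_smul volume
    isOpen_openTriangle.measurableSet (fun z _ => (hA z).hasFDerivWithinAt) injOn_parabolicMap]
  simp_rw [hdet, smul_eq_mul]
  congr 1 with z
  rw [abs_of_nonneg (by positivity)]

/-- The weight solving `ΔV = 4(p² + q²)` and vanishing to second order on `p + q = 1`. -/
def triangleWeight (z : ℝ × ℝ) : ℝ :=
  (1 - z.1 - z.2) ^ 2 * (1 / 6 + (z.1 + z.2) / 3 + (z.1 ^ 2 + z.2 ^ 2) / 2 - z.1 * z.2)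

/-- The partial derivative of `triangleWeight` in the first variable. -/
def triangleWeightFst (z : ℝ × ℝ) : ℝ :=
  -2 * (1 - z.1 - z.2) * (1 / 6 + (z.1 + z.2) / 3 + (z.1 ^ 2 + z.2 ^ 2) / 2 - z.1 * z.2)
    + (1 - z.1 - z.2) ^ 2 * (1 / 3 + z.1 - z.2)

/-- The second partial derivative of `triangleWeight` in the first variable. -/
def triangleWeightFstFst (z : ℝ × ℝ) : ℝ :=
  2 * (1 / 6 + (z.1 + z.2) / 3 + (z.1 ^ 2 + z.2 ^ 2) / 2 - z.1 * z.2)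
    - 4 * (1 - z.1 - z.2) * (1 / 3 + z.1 - z.2) + (1 - z.1 - z.2) ^ 2

lemma continuous_triangleWeight : Continuous triangleWeight := by
  unfold triangleWeight; fun_prop

lemma continuous_triangleWeightFstFst : Continuous triangleWeightFstFst := by
  unfold triangleWeightFstFst; fun_prop

lemma triangleWeight_swap (z : ℝ × ℝ) : triangleWeight z.swap = triangleWeight z := by
  simp only [triangleWeight, Prod.fst_swap, Prod.snd_swap]; ring

lemma hasDerivAt_triangleWeight (p q : ℝ) :
    HasDerivAt (fun t => triangleWeight (t, q)) (triangleWeightFst (p, q)) p := by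
  have hx := hasDerivAt_id' p
  have h1 : HasDerivAt (fun t : ℝ => 1 - t - q) (-1) p := (hx.const_sub 1).sub_const q
  have h2 : HasDerivAt (fun t : ℝ => 1 / 6 + (t + q) / 3 + (t ^ 2 + q ^ 2) / 2 - t * q)
      (1 / 3 + (2 * p) / 2 - 1 * q) p := by
    refine ((((hx.add_const q).div_const 3).const_add (1 / 6)).add
      (((hx.pow 2).add_const (q ^ 2)).div_const 2)).sub (hx.mul_const q) |>.congr_deriv ?_
    ring
  refine ((h1.pow 2).mul h2).congr_deriv ?_
  simp only [triangleWeightFst, Pi.pow_apply]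
  ring

lemma hasDerivAt_triangleWeightFst (p q : ℝ) :
    HasDerivAt (fun t => triangleWeightFst (t, q)) (triangleWeightFstFst (p, q)) p := by
  have hx := hasDerivAt_id' p
  have h1 : HasDerivAt (fun t : ℝ => 1 - t - q) (-1) p := (hx.const_sub 1).sub_const q
  have h2 : HasDerivAt (fun t : ℝ => 1 / 6 + (t + q) / 3 + (t ^ 2 + q ^ 2) / 2 - t * q)
      (1 / 3 + (2 * p) / 2 - 1 * q) p := by
    refine ((((hx.add_const q).div_const 3).const_add (1 / 6)).add
      (((hx.pow 2).add_const (q ^ 2)).div_const 2)).sub (hx.mul_const q) |>.congr_deriv ?_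
    ring
  have h3 : HasDerivAt (fun t : ℝ => 1 / 3 + t - q) 1 p := (hx.const_add (1 / 3)).sub_const q
  refine (((h1.const_mul (-2)).mul h2).add ((h1.pow 2).mul h3)).congr_deriv ?_
  simp only [triangleWeightFstFst, Pi.pow_apply]
  ring

lemma hasDerivAt_comp_parabolicMap_fst {g : ℝ × ℝ → ℝ} {g' : ℝ × ℝ →L[ℝ] ℝ} {p q : ℝ}
    (hg : HasFDerivAt g g' (parabolicMap (p, q))) :
    HasDerivAt (fun t => g (parabolicMap (t, q))) (2 * p * g' (1, 0) + 2 * q * g' (0, 1)) p := by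
  have hx := hasDerivAt_id' p
  have hc : HasDerivAt (fun t => parabolicMap (t, q)) (2 * p, 2 * q) p := by
    refine HasDerivAt.prodMk ?_ ?_
    · exact (((hx.pow 2).const_add 1).sub_const (q ^ 2)).congr_deriv (by simp)
    · exact ((hx.const_mul 2).mul_const q).congr_deriv (by simp)
  refine (hg.comp_hasDerivAt p hc).congr_deriv ?_
  have : ((2 * p, 2 * q) : ℝ × ℝ) = (2 * p) • (1, 0) + (2 * q) • (0, 1) := by simp
  rw [this, map_add, map_smul, map_smul, smul_eq_mul, smul_eq_mul]

lemma hasDerivAt_comp_parabolicMap_snd {g : ℝ × ℝ → ℝ} {g' : ℝ × ℝ →L[ℝ] ℝ} {p q : ℝ}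
    (hg : HasFDerivAt g g' (parabolicMap (p, q))) :
    HasDerivAt (fun t => g (parabolicMap (p, t))) (-2 * q * g' (1, 0) + 2 * p * g' (0, 1)) q := by
  have hx := hasDerivAt_id' q
  have hc : HasDerivAt (fun t => parabolicMap (p, t)) (-2 * q, 2 * p) q := by
    refine HasDerivAt.prodMk ?_ ?_
    · exact ((hx.pow 2).const_sub (1 + p ^ 2)).congr_deriv (by simp)
    · exact (hx.const_mul (2 * p)).congr_deriv (by simp)
  refine (hg.comp_hasDerivAt q hc).congr_deriv ?_
  have : ((-2 * q, 2 * p) : ℝ × ℝ) = (-2 * q) • (1, 0) + (2 * p) • (0, 1) := by simp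
  rw [this, map_add, map_smul, map_smul, smul_eq_mul, smul_eq_mul]

lemma HasFDerivAt.hasDerivAt_fst {g : ℝ × ℝ → ℝ} {g' : ℝ × ℝ →L[ℝ] ℝ} {x y : ℝ}
    (hg : HasFDerivAt g g' (x, y)) : HasDerivAt (fun t => g (t, y)) (g' (1, 0)) x :=
  hg.comp_hasDerivAt x ((hasDerivAt_id' x).prodMk (hasDerivAt_const x y))

lemma HasFDerivAt.hasDerivAt_snd {g : ℝ × ℝ → ℝ} {g' : ℝ × ℝ →L[ℝ] ℝ} {x y : ℝ}
    (hg : HasFDerivAt g g' (x, y)) : HasDerivAt (fun t => g (x, t)) (g' (0, 1)) y :=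
  hg.comp_hasDerivAt y ((hasDerivAt_const y x).prodMk (hasDerivAt_id' y))

section Harmonic

variable {U : Set (ℝ × ℝ)} {h : ℝ × ℝ → ℝ}

lemma ContDiffOn.hasFDerivAt_of_isOpen {n : WithTop ℕ∞} (hU : IsOpen U) (hh : ContDiffOn ℝ n h U)
    (hn : n ≠ 0) {w : ℝ × ℝ} (hw : w ∈ U) : HasFDerivAt h (fderiv ℝ h w) w :=
  ((hh.differentiableOn hn).differentiableAt (hU.mem_nhds hw)).hasFDerivAt

lemma ContDiffOn.fderiv_apply_of_isOpen (hU : IsOpen U) (hh : ContDiffOn ℝ 2 h U) (v : ℝ × ℝ) :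
    ContDiffOn ℝ 1 (fun w => fderiv ℝ h w v) U :=
  (hh.fderiv_of_isOpen hU (by norm_num [one_add_one_eq_two])).clm_apply contDiffOn_const

lemma lap2_eq_fderiv (hU : IsOpen U) (hh : ContDiffOn ℝ 2 h U) {w : ℝ × ℝ} (hw : w ∈ U) :
    lap2 h w = fderiv ℝ (fun w => fderiv ℝ h w (1, 0)) w (1, 0) +
      fderiv ℝ (fun w => fderiv ℝ h w (0, 1)) w (0, 1) := by
  obtain ⟨x, y⟩ := w
  unfold lap2
  congr 1
  · have hnear : deriv (fun t => h (t, y)) =ᶠ[nhds x] fun t => fderiv ℝ h (t, y) (1, 0) := by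
      have hc : Continuous fun t : ℝ => (t, y) := by fun_prop
      filter_upwards [hc.continuousAt.preimage_mem_nhds (hU.mem_nhds hw)] with t ht
      exact (hh.hasFDerivAt_of_isOpen hU two_ne_zero ht).hasDerivAt_fst.deriv
    exact hnear.deriv_eq.trans ((hh.fderiv_apply_of_isOpen hU (1, 0)).hasFDerivAt_of_isOpen
      hU one_ne_zero hw).hasDerivAt_fst.deriv
  · have hnear : deriv (fun t => h (x, t)) =ᶠ[nhds y] fun t => fderiv ℝ h (x, t) (0, 1) := by
      have hc : Continuous fun t : ℝ => (x, t) := by fun_prop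
      filter_upwards [hc.continuousAt.preimage_mem_nhds (hU.mem_nhds hw)] with t ht
      exact (hh.hasFDerivAt_of_isOpen hU two_ne_zero ht).hasDerivAt_snd.deriv
    exact hnear.deriv_eq.trans ((hh.fderiv_apply_of_isOpen hU (0, 1)).hasFDerivAt_of_isOpen
      hU one_ne_zero hw).hasDerivAt_snd.deriv

lemma setIntegral_upper_half (hU : IsOpen U) (hDU : closure domD ⊆ U)
    (hh : ContDiffOn ℝ 2 h U) (hharm : ∀ w ∈ U, lap2 h w = 0) :
    ∫ z in domD ∩ {z | 0 < z.2}, h z =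
      (∫ q in (0 : ℝ)..1, (h (1 - q ^ 2, 0) * (2 * q * (1 - q))
        + triangleWeight (0, q) * (2 * q * deriv (fun t => h (1 - q ^ 2, t)) 0)))
      + ∫ p in (0 : ℝ)..1, (h (1 + p ^ 2, 0) * (2 * p * (1 - p))
        + triangleWeight (0, p) * (2 * p * deriv (fun t => h (1 + p ^ 2, t)) 0)) := by
  have hmaps : MapsTo parabolicMap closedTriangle U := fun z hz =>
    hDU (parabolicMap_mem_closure_domD hz)
  have hφ := continuous_parabolicMap.continuousOn (s := closedTriangle)
  have hha := hh.fderiv_apply_of_isOpen hU (1, 0)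
  have hhb := hh.fderiv_apply_of_isOpen hU (0, 1)
  have dh {w} (hw : w ∈ U) := hh.hasFDerivAt_of_isOpen hU two_ne_zero hw
  have da {w} (hw : w ∈ U) := hha.hasFDerivAt_of_isOpen hU one_ne_zero hw
  have db {w} (hw : w ∈ U) := hhb.hasFDerivAt_of_isOpen hU one_ne_zero hw
  have hlap : ∀ w ∈ U, _ := fun w hw => (lap2_eq_fderiv hU hh hw).symm.trans (hharm w hw)
  have hax : ContinuousOn (fderiv ℝ fun w => fderiv ℝ h w (1, 0)) U :=
    hha.continuousOn_fderiv_of_isOpen hU le_rfl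
  have hbx : ContinuousOn (fderiv ℝ fun w => fderiv ℝ h w (0, 1)) U :=
    hhb.continuousOn_fderiv_of_isOpen hU le_rfl
  have hyd : ∀ x, (x, (0 : ℝ)) ∈ U → deriv (fun t => h (x, t)) 0 = fderiv ℝ h (x, 0) (0, 1) :=
    fun x hx => (dh hx).hasDerivAt_snd.deriv
  set a : ℝ × ℝ → ℝ := fun w => fderiv ℝ h w (1, 0) with ha
  set b : ℝ × ℝ → ℝ := fun w => fderiv ℝ h w (0, 1) with hb
  have ca : ContinuousOn (fun z => a (parabolicMap z)) closedTriangle :=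
    hha.continuousOn.comp hφ hmaps
  have cb : ContinuousOn (fun z => b (parabolicMap z)) closedTriangle :=
    hhb.continuousOn.comp hφ hmaps
  have ch : ContinuousOn (fun z => h (parabolicMap z)) closedTriangle :=
    hh.continuousOn.comp hφ hmaps
  have ca' (v : ℝ × ℝ) : ContinuousOn (fun z => fderiv ℝ a (parabolicMap z) v) closedTriangle :=
    (hax.comp hφ hmaps).clm_apply continuousOn_const
  have cb' (v : ℝ × ℝ) : ContinuousOn (fun z => fderiv ℝ b (parabolicMap z) v) closedTriangle :=
    (hbx.comp hφ hmaps).clm_apply continuousOn_const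
  have cV := continuous_triangleWeight.continuousOn (s := closedTriangle)
  have cV1 := continuous_triangleWeightFstFst.continuousOn (s := closedTriangle)
  have cV2 := (continuous_triangleWeightFstFst.comp continuous_swap).continuousOn
    (s := closedTriangle)
  let F : ℝ × ℝ → ℝ := fun z => h (parabolicMap z) * triangleWeightFst z
    - triangleWeight z * (2 * z.1 * a (parabolicMap z) + 2 * z.2 * b (parabolicMap z))
  let G : ℝ × ℝ → ℝ := fun z => h (parabolicMap z) * triangleWeightFst z.swap
    - triangleWeight z * (-2 * z.2 * a (parabolicMap z) + 2 * z.1 * b (parabolicMap z))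
  let F' : ℝ × ℝ → ℝ := fun z => h (parabolicMap z) * triangleWeightFstFst z
    - triangleWeight z * (2 * a (parabolicMap z)
      + 2 * z.1 * (2 * z.1 * fderiv ℝ a (parabolicMap z) (1, 0)
        + 2 * z.2 * fderiv ℝ a (parabolicMap z) (0, 1))
      + 2 * z.2 * (2 * z.1 * fderiv ℝ b (parabolicMap z) (1, 0)
        + 2 * z.2 * fderiv ℝ b (parabolicMap z) (0, 1)))
  let G' : ℝ × ℝ → ℝ := fun z => h (parabolicMap z) * triangleWeightFstFst z.swap
    - triangleWeight z * (-2 * a (parabolicMap z)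
      + -2 * z.2 * (-2 * z.2 * fderiv ℝ a (parabolicMap z) (1, 0)
        + 2 * z.1 * fderiv ℝ a (parabolicMap z) (0, 1))
      + 2 * z.1 * (-2 * z.2 * fderiv ℝ b (parabolicMap z) (1, 0)
        + 2 * z.1 * fderiv ℝ b (parabolicMap z) (0, 1)))
  have hF : ∀ z ∈ closedTriangle, HasDerivAt (fun t => F (t, z.2)) (F' z) z.1 := by
    rintro ⟨p, q⟩ hz
    have e0 := hasDerivAt_comp_parabolicMap_fst (dh (hmaps hz))
    have e1 := hasDerivAt_comp_parabolicMap_fst (da (hmaps hz))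
    have e2 := hasDerivAt_comp_parabolicMap_fst (db (hmaps hz))
    have hx := hasDerivAt_id' p
    refine ((e0.mul (hasDerivAt_triangleWeightFst p q)).sub
      ((hasDerivAt_triangleWeight p q).mul (((hx.const_mul 2).mul e1).add
        (e2.const_mul (2 * q))))).congr_deriv ?_
    simp only [F', ha, hb, Pi.add_apply, Pi.mul_apply]
    ring
  have hG : ∀ z ∈ closedTriangle, HasDerivAt (fun t => G (z.1, t)) (G' z) z.2 := by
    rintro ⟨p, q⟩ hz
    have e0 := hasDerivAt_comp_parabolicMap_snd (dh (hmaps hz))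
    have e1 := hasDerivAt_comp_parabolicMap_snd (da (hmaps hz))
    have e2 := hasDerivAt_comp_parabolicMap_snd (db (hmaps hz))
    have hx := hasDerivAt_id' q
    have e3 : HasDerivAt (fun t => triangleWeight (p, t)) (triangleWeightFst (q, p)) q :=
      (hasDerivAt_triangleWeight q p).congr_of_eventuallyEq
        (Filter.Eventually.of_forall fun t => triangleWeight_swap (t, p))
    refine ((e0.mul (hasDerivAt_triangleWeightFst q p)).sub
      (e3.mul (((hx.const_mul (-2)).mul e1).add
        (e2.const_mul (2 * p))))).congr_deriv ?_
    simp only [G', ha, hb, Prod.swap_prod_mk, Pi.add_apply, Pi.mul_apply]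
    ring
  have d1 : ContinuousOn (fun z : ℝ × ℝ => 2 * z.1) closedTriangle := by fun_prop
  have d2 : ContinuousOn (fun z : ℝ × ℝ => 2 * z.2) closedTriangle := by fun_prop
  have d3 : ContinuousOn (fun z : ℝ × ℝ => -2 * z.2) closedTriangle := by fun_prop
  have cF' : ContinuousOn F' closedTriangle :=
    (ch.mul cV1).sub (cV.mul (((continuousOn_const.mul ca).add
      (d1.mul ((d1.mul (ca' _)).add (d2.mul (ca' _))))).add
      (d2.mul ((d1.mul (cb' _)).add (d2.mul (cb' _))))))
  have cG' : ContinuousOn G' closedTriangle :=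
    (ch.mul cV2).sub (cV.mul (((continuousOn_const.mul ca).add
      (d3.mul ((d3.mul (ca' _)).add (d1.mul (ca' _))))).add
      (d1.mul ((d3.mul (cb' _)).add (d1.mul (cb' _))))))
  have hsum : ∀ z ∈ openTriangle,
      4 * (z.1 ^ 2 + z.2 ^ 2) * h (parabolicMap z) = F' z + G' z := by
    intro z hz
    have hl := hlap _ (hmaps (openTriangle_subset_closedTriangle hz))
    simp only [F', G', triangleWeightFstFst, Prod.fst_swap, Prod.snd_swap]
    linear_combination (triangleWeight z * 4 * (z.1 ^ 2 + z.2 ^ 2)) * hl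
  have hmem1 : ∀ p ∈ Icc (0 : ℝ) 1, (1 + p ^ 2, (0 : ℝ)) ∈ U := fun p hp => by
    simpa [parabolicMap] using @hmaps (p, 0) ⟨hp.1, le_rfl, by simpa using hp.2⟩
  have hmem2 : ∀ q ∈ Icc (0 : ℝ) 1, (1 - q ^ 2, (0 : ℝ)) ∈ U := fun q hq => by
    simpa [parabolicMap] using @hmaps (0, q) ⟨le_rfl, hq.1, by simpa using hq.2⟩
  rw [setIntegral_parabolicMap, setIntegral_congr_fun isOpen_openTriangle.measurableSet hsum,
    integral_add (integrableOn_openTriangle cF') (integrableOn_openTriangle cG'),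
    setIntegral_openTriangle_deriv_fst hF cF'
      (fun q => by simp [F, triangleWeight, triangleWeightFst]),
    setIntegral_openTriangle_deriv_snd hG cG'
      (fun p => by simp [G, triangleWeight, triangleWeightFst]),
    ← intervalIntegral.integral_neg, ← intervalIntegral.integral_neg]
  congr 1
  · refine intervalIntegral.integral_congr fun q hq => ?_
    rw [uIcc_of_le zero_le_one] at hq
    simp only [F, hyd _ (hmem2 q hq), parabolicMap, triangleWeightFst, triangleWeight, hb]
    ring_nf
  · refine intervalIntegral.integral_congr fun p hp => ?_
    rw [uIcc_of_le zero_le_one] at hp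
    simp only [G, hyd _ (hmem1 p hp), parabolicMap, triangleWeightFst, triangleWeight, hb,
      Prod.swap_prod_mk]
    ring_nf

end Harmonic

lemma neg_snd_mem_domD {z : ℝ × ℝ} (hz : z ∈ domD) : (z.1, -z.2) ∈ domD :=
  ⟨hz.1, hz.2.1, by simpa only [abs_neg] using hz.2.2⟩

lemma lap2_comp_neg_snd (h : ℝ × ℝ → ℝ) (z : ℝ × ℝ) :
    lap2 (fun w => h (w.1, -w.2)) z = lap2 h (z.1, -z.2) := by
  unfold lap2
  congr 1
  have h1 : deriv (fun y => h (z.1, -y)) = fun y => -deriv (fun t => h (z.1, t)) (-y) := by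
    ext y
    exact deriv_comp_neg (fun t => h (z.1, t)) y
  simp only [h1, deriv.fun_neg]
  rw [deriv_comp_neg (deriv fun t => h (z.1, t)), neg_neg]

lemma setIntegral_domD_eq_upper_half {h : ℝ × ℝ → ℝ} (hint : IntegrableOn h domD) :
    ∫ z in domD, h z = (∫ z in domD ∩ {z | 0 < z.2}, h z) +
      ∫ z in domD ∩ {z | 0 < z.2}, h (z.1, -z.2) := by
  have hm : MeasurableSet {z : ℝ × ℝ | 0 < z.2} := measurableSet_lt measurable_const measurable_snd
  rw [← integral_inter_add_sdiff hm hint]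
  congr 1
  let σ : ℝ × ℝ ≃ᵐ ℝ × ℝ := (MeasurableEquiv.refl ℝ).prodCongr (MeasurableEquiv.neg ℝ)
  have hσ : MeasurePreserving σ volume volume :=
    (MeasurePreserving.id volume).prod (Measure.measurePreserving_neg volume)
  rw [← hσ.setIntegral_preimage_emb σ.measurableEmbedding (fun z => h (z.1, -z.2))]
  have hfun : ∀ z : ℝ × ℝ, h ((σ z).1, -(σ z).2) = h z := fun z => by
    change h (z.1, - -z.2) = h z
    rw [neg_neg]
  simp only [hfun]
  refine setIntegral_congr_set ?_
  have hnull : volume {z : ℝ × ℝ | z.2 = 0} = 0 := by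
    have : {z : ℝ × ℝ | z.2 = 0} = univ ×ˢ {0} := by ext; simp
    rw [this, Measure.volume_eq_prod, Measure.prod_prod, Real.volume_singleton, mul_zero]
  have hae : ∀ᵐ z : ℝ × ℝ, z.2 ≠ 0 := by
    rw [ae_iff]; simpa using hnull
  filter_upwards [hae] with z hz
  refine propext ⟨fun h1 => ⟨neg_snd_mem_domD h1.1, ?_⟩, fun h1 => ⟨?_, ?_⟩⟩
  · have h2 : ¬ 0 < z.2 := h1.2
    exact neg_pos.2 (lt_of_le_of_ne (not_lt.1 h2) hz)
  · have h2 : (z.1, - -z.2) ∈ domD := neg_snd_mem_domD h1.1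
    rwa [neg_neg] at h2
  · have h2 : 0 < -z.2 := h1.2
    change ¬ 0 < z.2
    linarith

lemma ContDiffOn.continuousOn_deriv_snd {U : Set (ℝ × ℝ)} {h : ℝ × ℝ → ℝ} (hU : IsOpen U)
    (hh : ContDiffOn ℝ 2 h U) : ContinuousOn (fun z => deriv (fun t => h (z.1, t)) z.2) U :=
  (hh.fderiv_apply_of_isOpen hU (0, 1)).continuousOn.congr fun _ hw =>
    (hh.hasFDerivAt_of_isOpen hU two_ne_zero hw).hasDerivAt_snd.deriv

lemma integral_zero_two_eq {k : ℝ → ℝ} (hk : ContinuousOn k (Icc 0 2)) :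
    ∫ x in Icc (0 : ℝ) 2, k x = (∫ q in (0 : ℝ)..1, k (1 - q ^ 2) * (2 * q)) +
      ∫ p in (0 : ℝ)..1, k (1 + p ^ 2) * (2 * p) := by
  have hi : ∀ a ∈ Icc (0 : ℝ) 2, ∀ b ∈ Icc (0 : ℝ) 2, IntervalIntegrable k volume a b :=
    fun a ha b hb => (hk.mono (uIcc_subset_Icc ha hb)).intervalIntegrable
  have e1 : ∫ p in (0 : ℝ)..1, k (1 + p ^ 2) * (2 * p) = ∫ x in (1 : ℝ)..2, k x := by
    have := intervalIntegral.integral_comp_mul_deriv' (a := 0) (b := 1)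
      (f := fun p : ℝ => 1 + p ^ 2) (f' := fun p => 2 * p) (g := k)
      (fun p _ => by simpa using ((hasDerivAt_id' p).pow 2).const_add 1) (by fun_prop)
      (hk.mono ?_)
    · norm_num [Function.comp_def] at this
      exact this
    · rw [uIcc_of_le zero_le_one]
      rintro _ ⟨p, ⟨hp0, hp1⟩, rfl⟩
      exact ⟨by simp only; nlinarith, by simp only; nlinarith⟩
  have e2 : ∫ q in (0 : ℝ)..1, k (1 - q ^ 2) * (2 * q) = ∫ x in (0 : ℝ)..1, k x := by
    have := intervalIntegral.integral_comp_mul_deriv' (a := 0) (b := 1)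
      (f := fun q : ℝ => 1 - q ^ 2) (f' := fun q => -(2 * q)) (g := k)
      (fun q _ => by simpa using ((hasDerivAt_id' q).pow 2).const_sub 1) (by fun_prop)
      (hk.mono ?_)
    · norm_num [Function.comp_def] at this
      have hsymm := intervalIntegral.integral_symm (μ := volume) (f := k) 0 1
      linarith
    · rw [uIcc_of_le zero_le_one]
      rintro _ ⟨q, ⟨hq0, hq1⟩, rfl⟩
      exact ⟨by simp only; nlinarith, by simp only; nlinarith⟩
  rw [e1, e2, intervalIntegral.integral_add_adjacent_intervals (hi _ (by simp) _ (by simp))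
    (hi _ (by simp) _ (by simp)), intervalIntegral.integral_of_le zero_le_two,
    integral_Icc_eq_integral_Ioc]

/-- `D` is a quadrature domain for the measure `2(1 − √|x−1|) dx` on
`[0,2] × {0}`: for every integrable harmonic function `h` on (a neighborhood of the
closure of) `D`, `∫_D h = ∫₀² h(x,0)·2(1 − √|x−1|) dx`. -/
theorem stmt16 (U : Set (ℝ × ℝ)) (hU : IsOpen U) (hDU : closure domD ⊆ U)
    (h : ℝ × ℝ → ℝ) (hC2 : ContDiffOn ℝ 2 h U)
    (hharm : ∀ p ∈ U, lap2 h p = 0)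
    (hint : IntegrableOn h domD volume) :
    ∫ p in domD, h p = ∫ x in Icc (0 : ℝ) 2, h (x, 0) * (2 * (1 - Real.sqrt |x - 1|)) := by
  have hσ : Continuous fun z : ℝ × ℝ => (z.1, -z.2) := by fun_prop
  have hDU' : closure domD ⊆ (fun z : ℝ × ℝ => (z.1, -z.2)) ⁻¹' U := fun z hz =>
    hDU (map_mem_closure (f := fun z : ℝ × ℝ => (z.1, -z.2)) hσ hz fun _ hw => neg_snd_mem_domD hw)
  have hC2' : ContDiffOn ℝ 2 (fun z => h (z.1, -z.2)) ((fun z : ℝ × ℝ => (z.1, -z.2)) ⁻¹' U) :=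
    hC2.comp (by fun_prop) fun _ hz => hz
  have hharm' : ∀ z ∈ (fun z : ℝ × ℝ => (z.1, -z.2)) ⁻¹' U,
      lap2 (fun z => h (z.1, -z.2)) z = 0 := fun z hz =>
    (lap2_comp_neg_snd h z).trans (hharm _ hz)
  have haxis : ∀ x ∈ Icc (0 : ℝ) 2, (x, (0 : ℝ)) ∈ U := fun x hx => by
    have h1 : |x - 1| ≤ 1 := abs_le.2 ⟨by linarith [hx.1], by linarith [hx.2]⟩
    refine hDU (mem_closure_domD h1 ?_)
    have := (sq_le_one_iff_abs_le_one (x - 1)).2 h1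
    simp only [abs_zero]
    linarith
  have hh0 : ContinuousOn (fun x : ℝ => h (x, 0)) (Icc 0 2) :=
    hC2.continuousOn.comp (by fun_prop) haxis
  have hd0 : ContinuousOn (fun x : ℝ => deriv (fun t => h (x, t)) 0) (Icc 0 2) :=
    (hC2.continuousOn_deriv_snd hU).comp (f := fun x : ℝ => (x, (0 : ℝ))) (by fun_prop) haxis
  have hneg : ∀ x, deriv (fun t => h (x, -t)) 0 = -deriv (fun t => h (x, t)) 0 := fun x => by
    simpa using deriv_comp_neg (fun t => h (x, t)) 0
  have hm1 : MapsTo (fun p : ℝ => 1 + p ^ 2) (uIcc 0 1) (Icc 0 2) := by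
    rw [uIcc_of_le zero_le_one]
    rintro p ⟨hp0, hp1⟩
    exact ⟨by simp only; nlinarith, by simp only; nlinarith⟩
  have hm2 : MapsTo (fun q : ℝ => 1 - q ^ 2) (uIcc 0 1) (Icc 0 2) := by
    rw [uIcc_of_le zero_le_one]
    rintro q ⟨hq0, hq1⟩
    exact ⟨by simp only; nlinarith, by simp only; nlinarith⟩
  have cW : Continuous fun q : ℝ => triangleWeight (0, q) :=
    continuous_triangleWeight.comp (by fun_prop)
  have ch1 : ContinuousOn (fun p : ℝ => h (1 + p ^ 2, 0)) (uIcc 0 1) :=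
    hh0.comp (by fun_prop) hm1
  have ch2 : ContinuousOn (fun q : ℝ => h (1 - q ^ 2, 0)) (uIcc 0 1) :=
    hh0.comp (by fun_prop) hm2
  have cd1 : ContinuousOn (fun p : ℝ => deriv (fun t => h (1 + p ^ 2, t)) 0) (uIcc 0 1) :=
    hd0.comp (f := fun p : ℝ => 1 + p ^ 2) (by fun_prop) hm1
  have cd2 : ContinuousOn (fun q : ℝ => deriv (fun t => h (1 - q ^ 2, t)) 0) (uIcc 0 1) :=
    hd0.comp (f := fun q : ℝ => 1 - q ^ 2) (by fun_prop) hm2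
  have d1 : ContinuousOn (fun t : ℝ => 2 * t) (uIcc 0 1) := by fun_prop
  rw [setIntegral_domD_eq_upper_half hint, setIntegral_upper_half hU hDU hC2 hharm,
    setIntegral_upper_half (hU.preimage hσ) hDU' hC2' hharm', integral_zero_two_eq]
  · simp only [neg_zero, hneg]
    rw [add_add_add_comm, ← intervalIntegral.integral_add, ← intervalIntegral.integral_add]
    · congr 1
      · refine intervalIntegral.integral_congr fun q hq => ?_
        rw [uIcc_of_le zero_le_one] at hq
        have : √|1 - q ^ 2 - 1| = q := by
          rw [sub_sub_cancel_left, abs_neg, abs_sq, Real.sqrt_sq hq.1]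
        simp only [this]
        ring
      · refine intervalIntegral.integral_congr fun p hp => ?_
        rw [uIcc_of_le zero_le_one] at hp
        have : √|1 + p ^ 2 - 1| = p := by
          rw [add_sub_cancel_left, abs_sq, Real.sqrt_sq hp.1]
        simp only [this]
        ring
    · exact ((ch1.mul (by fun_prop)).add
        (cW.continuousOn.mul (d1.mul cd1))).intervalIntegrable
    · exact ((ch1.mul (by fun_prop)).add
        (cW.continuousOn.mul (d1.mul cd1.neg))).intervalIntegrable
    · exact ((ch2.mul (by fun_prop)).add
        (cW.continuousOn.mul (d1.mul cd2))).intervalIntegrable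
    · exact ((ch2.mul (by fun_prop)).add
        (cW.continuousOn.mul (d1.mul cd2.neg))).intervalIntegrable
  · exact hh0.mul (by fun_prop)
end
end
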